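/- arXiv:2407.05286 — 6 statements merged into one kernel-verified Lean document; each statement's English description precedes it below -/
import Mathlib

section
/- There is an absolute numerical constant C (independent of all problem parameters) with the following property. In the one-level STORM setting with perturbed dataset S^k, assume in addition that f_S and f_{S^k} are convex, that ∇f_S and ∇f_{S^k} are L-Lipschitz, that η ≤ 2/(3L), and that T ≥ n. Then the coupled STORM runs satisfy E_A‖x_T − x_T^k‖ ≤ C ( η ∑_{j=0}^{T−1} max{ (E_A‖v_j − ∇f_S(x_j)‖²)^{1/2}, (E_A‖v_j^k − ∇f_{S^k}(x_j^k)‖²)^{1/2} } + L_f η T / n ). -/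
open MeasureTheory
open scoped ENNReal

/-- Euclidean projection onto the closed ball of radius `r` centered at the origin. -/
noncomputable def projBall {E : Type*} [NormedAddCommGroup E] [NormedSpace ℝ E]
    (r : ℝ) (v : E) : E :=
  if ‖v‖ ≤ r then v else (r / ‖v‖) • v

namespace StormAux

variable {E : Type*} [NormedAddCommGroup E] [InnerProductSpace ℝ E] [CompleteSpace E]

/-- First-order characterisation of convexity. -/
lemma convex_grad {g : E → ℝ} (hg : ConvexOn ℝ Set.univ g) (hd : Differentiable ℝ g) (a b : E) :
    g a + inner ℝ (gradient g a) (b - a) ≤ g b := by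
  have h1 : ConvexOn ℝ Set.univ (g ∘ (AffineMap.lineMap a b : ℝ →ᵃ[ℝ] E)) := by
    simpa using hg.comp_affineMap (AffineMap.lineMap a b : ℝ →ᵃ[ℝ] E)
  have h2 : HasDerivAt (g ∘ (AffineMap.lineMap a b : ℝ →ᵃ[ℝ] E))
      (fderiv ℝ g a (b - a)) 0 := by
    have h3 : HasDerivAt (AffineMap.lineMap a b : ℝ →ᵃ[ℝ] E) (b - a) (0 : ℝ) :=
      AffineMap.hasDerivAt_lineMap
    have h4 : HasFDerivAt g (fderiv ℝ g a) ((AffineMap.lineMap a b : ℝ →ᵃ[ℝ] E) 0) := by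
      simpa using (hd a).hasFDerivAt
    exact h4.comp_hasDerivAt (0 : ℝ) h3
  have h5 := h1.le_slope_of_hasDerivAt (Set.mem_univ 0) (Set.mem_univ 1) one_pos h2
  have h6 : inner ℝ (gradient g a) (b - a) = fderiv ℝ g a (b - a) := by
    rw [← toDual_gradient]; rfl
  rw [h6]
  simp [slope_def_field] at h5
  simp
  linarith

lemma half_coco {g : E → ℝ} {L : ℝ} (hL : 0 < L) (hg : ConvexOn ℝ Set.univ g)
    (hd : Differentiable ℝ g)
    (hl : ∀ a b, ‖gradient g a - gradient g b‖ ≤ L * ‖a - b‖) (x y : E) :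
    g x + inner ℝ (gradient g x) (y - x) + ‖gradient g y - gradient g x‖ ^ 2 / (4 * L) ≤ g y := by
  set w := gradient g y - gradient g x with hw
  set s : ℝ := 1 / (2 * L) with hs
  have hs0 : 0 < s := by positivity
  set z := y - s • w with hz
  have h1 := convex_grad hg hd x z
  have h2 := convex_grad hg hd z y
  have h3 := hl z y
  have h4 : z - y = -(s • w) := by rw [hz]; abel
  rw [h4, norm_neg, norm_smul, Real.norm_of_nonneg hs0.le] at h3
  have h5 : |inner ℝ (gradient g z - gradient g y) w| ≤ L * (s * ‖w‖) * ‖w‖ :=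
    (abs_real_inner_le_norm _ _).trans (mul_le_mul_of_nonneg_right h3 (norm_nonneg _))
  have h5' := (abs_le.1 h5).1
  have h6 : inner ℝ (gradient g x) (z - x) + inner ℝ (gradient g z) (y - z)
      = inner ℝ (gradient g x) (y - x)
        + s * (‖w‖ ^ 2 + inner ℝ (gradient g z - gradient g y) w) := by
    have e1 : y - z = s • w := by rw [hz]; abel
    have e2 : z - x = (y - x) - s • w := by rw [hz]; abel
    rw [e1, e2, inner_sub_right, inner_smul_right, inner_smul_right, ← real_inner_self_eq_norm_sq,
      ← inner_add_left]
    have e3 : w + (gradient g z - gradient g y) = gradient g z - gradient g x := by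
      rw [hw]; abel
    rw [e3, inner_sub_left]; ring
  have h7 : s * (‖w‖ ^ 2 + -(L * (s * ‖w‖) * ‖w‖)) = ‖w‖ ^ 2 / (4 * L) := by
    rw [hs]; field_simp; ring
  have h8 : s * (‖w‖ ^ 2 + -(L * (s * ‖w‖) * ‖w‖))
      ≤ s * (‖w‖ ^ 2 + inner ℝ (gradient g z - gradient g y) w) := by gcongr
  linarith

lemma step_nonexp {g : E → ℝ} {L η : ℝ} (hL : 0 < L) (hη : 0 < η) (hηL : η ≤ 2 / (3 * L))
    (hg : ConvexOn ℝ Set.univ g) (hd : Differentiable ℝ g)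
    (hl : ∀ a b, ‖gradient g a - gradient g b‖ ≤ L * ‖a - b‖) (x y : E) :
    ‖(x - y) - η • (gradient g x - gradient g y)‖ ≤ ‖x - y‖ := by
  have h1 := half_coco hL hg hd hl x y
  have h2 := half_coco hL hg hd hl y x
  rw [norm_sub_rev] at h1
  set G := gradient g x - gradient g y with hG
  have h3 : inner ℝ (gradient g x) (y - x) + inner ℝ (gradient g y) (x - y)
      = - inner ℝ (x - y) G := by
    rw [hG, inner_sub_right (x - y), real_inner_comm (gradient g x) (x - y),
      real_inner_comm (gradient g y) (x - y), ← neg_sub x y, inner_neg_right]; ring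
  have h4 : ‖G‖ ^ 2 / (2 * L) ≤ inner ℝ (x - y) G := by
    have : ‖G‖ ^ 2 / (2 * L) = ‖G‖ ^ 2 / (4 * L) + ‖G‖ ^ 2 / (4 * L) := by field_simp; ring
    linarith
  have h5 : η * ‖G‖ ^ 2 ≤ 2 * inner ℝ (x - y) G := by
    have : η * ‖G‖ ^ 2 ≤ 1 / L * ‖G‖ ^ 2 := by
      gcongr
      refine hηL.trans ?_
      rw [div_le_div_iff₀ (by positivity) hL]; nlinarith
    have e : 1 / L * ‖G‖ ^ 2 = 2 * (‖G‖ ^ 2 / (2 * L)) := by field_simp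
    linarith
  refine le_of_sq_le_sq ?_ (norm_nonneg _)
  rw [norm_sub_sq_real, inner_smul_right, norm_smul, Real.norm_of_nonneg hη.le]
  nlinarith [mul_le_mul_of_nonneg_left h5 hη.le]

lemma grad_diff {n : ℕ} {Lf : ℝ} (hLf : 0 ≤ Lf) (f f' : Fin n → E → ℝ) (k : Fin n)
    (h : ∀ i, i ≠ k → f' i = f i)
    (hd : ∀ i, Differentiable ℝ (f i)) (hd' : ∀ i, Differentiable ℝ (f' i))
    (hl : ∀ i a b, |f i a - f i b| ≤ Lf * ‖a - b‖)
    (hl' : ∀ i a b, |f' i a - f' i b| ≤ Lf * ‖a - b‖) (y : E) :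
    ‖gradient (fun x => (n : ℝ)⁻¹ * ∑ i, f' i x) y - gradient (fun x => (n : ℝ)⁻¹ * ∑ i, f i x) y‖
      ≤ 2 * Lf / n := by
  have hD : Differentiable ℝ (fun x => (n : ℝ)⁻¹ * ∑ i, f i x) := by fun_prop
  have hD' : Differentiable ℝ (fun x => (n : ℝ)⁻¹ * ∑ i, f' i x) := by fun_prop
  rw [← (InnerProductSpace.toDual ℝ E).norm_map, map_sub, toDual_gradient, toDual_gradient,
    ← fderiv_sub (hD' y) (hD y)]
  refine norm_fderiv_le_of_lip' ℝ (by positivity) (Filter.Eventually.of_forall fun z => ?_)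
  have key : ∀ z, ((fun x => (n : ℝ)⁻¹ * ∑ i, f' i x) - (fun x => (n : ℝ)⁻¹ * ∑ i, f i x)) z
      = (n : ℝ)⁻¹ * (f' k z - f k z) := by
    intro z
    simp only [Pi.sub_apply]
    rw [← mul_sub, ← Finset.sum_sub_distrib, Finset.sum_eq_single k]
    · intro i _ hi; rw [h i hi, sub_self]
    · simp
  rw [key, key, ← mul_sub, norm_mul, norm_inv, Real.norm_natCast, Real.norm_eq_abs]
  have e : 2 * Lf / n * ‖z - y‖ = (n : ℝ)⁻¹ * (Lf * ‖z - y‖ + Lf * ‖z - y‖) := by ring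
  rw [e]
  gcongr
  have e2 : f' k z - f k z - (f' k y - f k y) = (f' k z - f' k y) - (f k z - f k y) := by ring
  rw [e2]
  exact (abs_sub _ _).trans (add_le_add (hl' k z y) (hl k z y))

lemma int_le_sqrt {Ω : Type} [MeasurableSpace Ω] (P : Measure Ω) [IsProbabilityMeasure P]
    (a : Ω → ℝ) (h1 : Integrable a P) (h2 : Integrable (fun ω => a ω ^ 2) P) :
    ∫ ω, a ω ∂P ≤ Real.sqrt (∫ ω, a ω ^ 2 ∂P) := by
  apply Real.le_sqrt_of_sq_le
  set m := ∫ ω, a ω ∂P with hm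
  have h3 : 0 ≤ ∫ ω, (a ω - m) ^ 2 ∂P := integral_nonneg fun ω => sq_nonneg _
  have h4 : ∫ ω, (a ω - m) ^ 2 ∂P = ∫ ω, a ω ^ 2 ∂P - 2 * m * m + m ^ 2 := by
    have : (fun ω => (a ω - m) ^ 2) = fun ω => a ω ^ 2 - 2 * m * a ω + m ^ 2 := by
      funext ω; ring
    have h5 : Integrable (fun ω => a ω ^ 2 - 2 * m * a ω) P := h2.sub (h1.const_mul _)
    rw [this, integral_add h5 (integrable_const _),
      integral_sub h2 (h1.const_mul _), integral_const_mul, ← hm]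
    simp
  nlinarith

/-- Being a simple function of the sample point. -/
def IsSimple {Ω X : Type*} [MeasurableSpace Ω] (g : Ω → X) : Prop :=
  ∃ s : SimpleFunc Ω X, ∀ ω, g ω = s ω

lemma IsSimple.map {Ω X Y : Type*} [MeasurableSpace Ω] {g : Ω → X} (hg : IsSimple g)
    (F : X → Y) : IsSimple (fun ω => F (g ω)) := by
  obtain ⟨s, hs⟩ := hg
  exact ⟨s.map F, fun ω => by simp [hs]⟩

lemma IsSimple.pair {Ω X Y : Type*} [MeasurableSpace Ω] {g : Ω → X} {h : Ω → Y}
    (hg : IsSimple g) (hh : IsSimple h) : IsSimple (fun ω => (g ω, h ω)) := by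
  obtain ⟨s, hs⟩ := hg
  obtain ⟨r, hr⟩ := hh
  exact ⟨s.pair r, fun ω => by simp [hs, hr]⟩

lemma IsSimple.integrable {Ω X : Type*} [MeasurableSpace Ω] (P : Measure Ω)
    [IsProbabilityMeasure P] {g : Ω → X} (hg : IsSimple g) (F : X → ℝ) :
    Integrable (fun ω => F (g ω)) P := by
  obtain ⟨s, hs⟩ := hg.map F
  exact (funext hs : _ = ⇑s) ▸ s.integrable_of_isFiniteMeasure

lemma run_simple {Ω : Type*} [MeasurableSpace Ω] {n : ℕ} (J : ℕ → Ω → Fin n)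
    (hJ : ∀ t, Measurable (J t)) (x v : ℕ → Ω → E) (x₀ v₀ : E)
    (hx0 : ∀ ω, x 0 ω = x₀) (hv0 : ∀ ω, v 0 ω = v₀) (F : Fin n × E × E → E × E)
    (hs : ∀ t ω, (x (t + 1) ω, v (t + 1) ω) = F (J (t + 1) ω, x t ω, v t ω)) (t : ℕ) :
    IsSimple (fun ω => (x t ω, v t ω)) := by
  induction t with
  | zero => exact ⟨SimpleFunc.const Ω (x₀, v₀), fun ω => by simp [hx0, hv0]⟩
  | succ t ih =>
    have hJ' : IsSimple (J (t + 1)) :=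
      ⟨⟨J (t + 1), fun i => hJ _ (measurableSet_singleton i), Set.toFinite _⟩, fun ω => rfl⟩
    obtain ⟨s, h⟩ := (hJ'.pair ih).map F
    exact ⟨s, fun ω => (hs t ω).trans (h ω)⟩

end StormAux

/-- Stability of coupled STORM runs on neighbouring datasets, convex setting:
there is an absolute constant `C` such that
`E_A‖x_T − x_T^k‖ ≤ C (η ∑_{j<T} max(√E‖v_j − ∇f_S(x_j)‖², √E‖v_j^k − ∇f_{S^k}(x_j^k)‖²)
  + L_f η T / n)`. -/
theorem stmt_1 :
    ∃ C : ℝ, 0 < C ∧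
      ∀ (d n T : ℕ), 0 < n → n ≤ T →
      ∀ (Lf L η β : ℝ), 0 < η → η < 1 → 0 < β → β < 1 → η ≤ 2 / (3 * L) →
      ∀ (f f' : Fin n → EuclideanSpace ℝ (Fin d) → ℝ) (k : Fin n),
        (∀ i, i ≠ k → f' i = f i) →
        (∀ i, Differentiable ℝ (f i)) → (∀ i, Differentiable ℝ (f' i)) →
        (∀ i a b, |f i a - f i b| ≤ Lf * ‖a - b‖) →
        (∀ i a b, |f' i a - f' i b| ≤ Lf * ‖a - b‖) →
      ∀ (fS fS' : EuclideanSpace ℝ (Fin d) → ℝ),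
        fS = (fun x => (n : ℝ)⁻¹ * ∑ i, f i x) →
        fS' = (fun x => (n : ℝ)⁻¹ * ∑ i, f' i x) →
        ConvexOn ℝ Set.univ fS → ConvexOn ℝ Set.univ fS' →
        (∀ a b, ‖gradient fS a - gradient fS b‖ ≤ L * ‖a - b‖) →
        (∀ a b, ‖gradient fS' a - gradient fS' b‖ ≤ L * ‖a - b‖) →
      ∀ (Ω : Type) (_ : MeasurableSpace Ω) (P : Measure Ω), IsProbabilityMeasure P →
      ∀ (J : ℕ → Ω → Fin n),
        (∀ t, Measurable (J t)) →
        (∀ t i, P {ω | J t ω = i} = (n : ℝ≥0∞)⁻¹) →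
        (∀ (s : Finset ℕ) (κ : ℕ → Fin n),
          P {ω | ∀ t ∈ s, J t ω = κ t} = ∏ t ∈ s, P {ω | J t ω = κ t}) →
      ∀ (x v x' v' : ℕ → Ω → EuclideanSpace ℝ (Fin d))
        (x₀ v₀ v₀' : EuclideanSpace ℝ (Fin d)),
        ‖v₀‖ ≤ Lf → ‖v₀'‖ ≤ Lf →
        (∀ ω, x 0 ω = x₀) → (∀ ω, x' 0 ω = x₀) →
        (∀ ω, v 0 ω = v₀) → (∀ ω, v' 0 ω = v₀') →
        (∀ t ω, x (t + 1) ω = x t ω - η • v t ω) →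
        (∀ t ω, x' (t + 1) ω = x' t ω - η • v' t ω) →
        (∀ t ω, v (t + 1) ω = projBall Lf
          (gradient (f (J (t + 1) ω)) (x (t + 1) ω)
            + (1 - β) • (v t ω - gradient (f (J (t + 1) ω)) (x t ω)))) →
        (∀ t ω, v' (t + 1) ω = projBall Lf
          (gradient (f' (J (t + 1) ω)) (x' (t + 1) ω)
            + (1 - β) • (v' t ω - gradient (f' (J (t + 1) ω)) (x' t ω)))) →
        ∫ ω, ‖x T ω - x' T ω‖ ∂P ≤
          C * (η * ∑ j ∈ Finset.range T,
                max (Real.sqrt (∫ ω, ‖v j ω - gradient fS (x j ω)‖ ^ 2 ∂P))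
                    (Real.sqrt (∫ ω, ‖v' j ω - gradient fS' (x' j ω)‖ ^ 2 ∂P))
              + Lf * η * T / n) := by
  refine ⟨2, two_pos, ?_⟩
  intro d n T hn hnT Lf L η β hη hη1 hβ hβ1 hηL f f' k hff hd hd' hl hl' fS fS' hfS hfS'
    hc hc' hg hg' Ω _ P _ J hJ _ _ x v x' v' x₀ v₀ v₀' hv0n hv0n' hx0 hx0' hv0 hv0' hx hx' hv hv'
  have hL : 0 < L := by
    by_contra hneg
    have : 2 / (3 * L) ≤ 0 := div_nonpos_of_nonneg_of_nonpos (by norm_num) (by linarith)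
    linarith
  have hLf : 0 ≤ Lf := (norm_nonneg _).trans hv0n
  have hD : Differentiable ℝ fS := by rw [hfS]; fun_prop
  have hgd : ∀ y, ‖gradient fS' y - gradient fS y‖ ≤ 2 * Lf / n := by
    intro y; rw [hfS, hfS']
    exact StormAux.grad_diff hLf f f' k hff hd hd' hl hl' y
  have hS := StormAux.run_simple J hJ x v x₀ v₀ hx0 hv0
    (fun p => (p.2.1 - η • p.2.2, projBall Lf (gradient (f p.1) (p.2.1 - η • p.2.2)
      + (1 - β) • (p.2.2 - gradient (f p.1) p.2.1))))
    (fun t ω => by simp only [hv, hx])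
  have hS' := StormAux.run_simple J hJ x' v' x₀ v₀' hx0' hv0'
    (fun p => (p.2.1 - η • p.2.2, projBall Lf (gradient (f' p.1) (p.2.1 - η • p.2.2)
      + (1 - β) • (p.2.2 - gradient (f' p.1) p.2.1))))
    (fun t ω => by simp only [hv', hx'])
  have hiD : ∀ t, Integrable (fun ω => ‖x t ω - x' t ω‖) P := fun t =>
    ((hS t).pair (hS' t)).integrable P (fun p => ‖p.1.1 - p.2.1‖)
  have hia : ∀ t, Integrable (fun ω => ‖v t ω - gradient fS (x t ω)‖) P := fun t =>
    (hS t).integrable P (fun p => ‖p.2 - gradient fS p.1‖)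
  have hia2 : ∀ t, Integrable (fun ω => ‖v t ω - gradient fS (x t ω)‖ ^ 2) P := fun t =>
    (hS t).integrable P (fun p => ‖p.2 - gradient fS p.1‖ ^ 2)
  have hib : ∀ t, Integrable (fun ω => ‖v' t ω - gradient fS' (x' t ω)‖) P := fun t =>
    (hS' t).integrable P (fun p => ‖p.2 - gradient fS' p.1‖)
  have hib2 : ∀ t, Integrable (fun ω => ‖v' t ω - gradient fS' (x' t ω)‖ ^ 2) P := fun t =>
    (hS' t).integrable P (fun p => ‖p.2 - gradient fS' p.1‖ ^ 2)
  -- one-step pathwise bound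
  have hstep : ∀ t ω, ‖x (t + 1) ω - x' (t + 1) ω‖ ≤ ‖x t ω - x' t ω‖
      + η * ‖v t ω - gradient fS (x t ω)‖ + η * ‖v' t ω - gradient fS' (x' t ω)‖
      + η * (2 * Lf / n) := by
    intro t ω
    have e : x (t + 1) ω - x' (t + 1) ω
        = ((x t ω - x' t ω) - η • (gradient fS (x t ω) - gradient fS (x' t ω)))
          - η • (v t ω - gradient fS (x t ω)) + η • (v' t ω - gradient fS' (x' t ω))
          + η • (gradient fS' (x' t ω) - gradient fS (x' t ω)) := by
      rw [hx, hx']; module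
    rw [e]
    have n1 := StormAux.step_nonexp hL hη hηL hc hD hg (x t ω) (x' t ω)
    refine (norm_add_le _ _).trans (add_le_add ((norm_add_le _ _).trans
      (add_le_add ((norm_sub_le _ _).trans (add_le_add n1 ?_)) ?_)) ?_)
    · rw [norm_smul, Real.norm_of_nonneg hη.le]
    · rw [norm_smul, Real.norm_of_nonneg hη.le]
    · rw [norm_smul, Real.norm_of_nonneg hη.le]
      exact mul_le_mul_of_nonneg_left (hgd _) hη.le
  -- one-step bound in expectation
  have hE : ∀ t, ∫ ω, ‖x (t + 1) ω - x' (t + 1) ω‖ ∂P ≤ ∫ ω, ‖x t ω - x' t ω‖ ∂P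
      + 2 * η * max (Real.sqrt (∫ ω, ‖v t ω - gradient fS (x t ω)‖ ^ 2 ∂P))
                    (Real.sqrt (∫ ω, ‖v' t ω - gradient fS' (x' t ω)‖ ^ 2 ∂P))
      + η * (2 * Lf / n) := by
    intro t
    have i1 := integral_mono (hiD (t + 1))
      ((((hiD t).add ((hia t).const_mul η)).add ((hib t).const_mul η)).add
        (integrable_const (η * (2 * Lf / n)))) (hstep t)
    have i2 : ∫ ω, (‖x t ω - x' t ω‖
      + η * ‖v t ω - gradient fS (x t ω)‖ + η * ‖v' t ω - gradient fS' (x' t ω)‖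
      + η * (2 * Lf / n)) ∂P = ∫ ω, ‖x t ω - x' t ω‖ ∂P
      + η * ∫ ω, ‖v t ω - gradient fS (x t ω)‖ ∂P
      + η * ∫ ω, ‖v' t ω - gradient fS' (x' t ω)‖ ∂P + η * (2 * Lf / n) := by
      have k1 : Integrable (fun ω => ‖x t ω - x' t ω‖
          + η * ‖v t ω - gradient fS (x t ω)‖) P := (hiD t).add ((hia t).const_mul η)
      have k2 : Integrable (fun ω => ‖x t ω - x' t ω‖ + η * ‖v t ω - gradient fS (x t ω)‖
          + η * ‖v' t ω - gradient fS' (x' t ω)‖) P := k1.add ((hib t).const_mul η)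
      rw [integral_add k2 (integrable_const _), integral_add k1
        ((hib t).const_mul η), integral_add (hiD t) ((hia t).const_mul η),
        integral_const_mul, integral_const_mul]
      simp
    have c1 := (StormAux.int_le_sqrt P _ (hia t) (hia2 t)).trans (le_max_left _
      (Real.sqrt (∫ ω, ‖v' t ω - gradient fS' (x' t ω)‖ ^ 2 ∂P)))
    have c2 := (StormAux.int_le_sqrt P _ (hib t) (hib2 t)).trans (le_max_right
      (Real.sqrt (∫ ω, ‖v t ω - gradient fS (x t ω)‖ ^ 2 ∂P)) _)
    have c3 := mul_le_mul_of_nonneg_left c1 hη.le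
    have c4 := mul_le_mul_of_nonneg_left c2 hη.le
    have i3 := i1.trans_eq i2
    linarith
  have hmain : ∀ t : ℕ, ∫ ω, ‖x t ω - x' t ω‖ ∂P ≤
      2 * (η * ∑ j ∈ Finset.range t,
            max (Real.sqrt (∫ ω, ‖v j ω - gradient fS (x j ω)‖ ^ 2 ∂P))
                (Real.sqrt (∫ ω, ‖v' j ω - gradient fS' (x' j ω)‖ ^ 2 ∂P))
          + Lf * η * t / n) := by
    intro t
    induction t with
    | zero => simp [hx0, hx0']
    | succ t ih =>
      rw [Finset.sum_range_succ]
      have e : 2 * (Lf * η * ((t + 1 : ℕ) : ℝ) / n)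
          = 2 * (Lf * η * t / n) + η * (2 * Lf / n) := by push_cast; ring
      have := hE t
      linarith
  exact hmain T
end

section
/- In the one-level STORM setting, assume in addition: f_S is convex with a minimizer x_*^S ∈ ℝ^d; E_A‖x_t − x_*^S‖² ≤ D_x for all 1 ≤ t ≤ T+1; V ≥ E_A‖v_0 − ∇f_S(x_0)‖²; σ_J ≥ 0; and the estimator-error recursion holds: for all t ≥ 1, E_A‖v_t − ∇f_S(x_t)‖² ≤ (1−β) E_A‖v_{t−1} − ∇f_S(x_{t−1})‖² + 2β²σ_J² + L_f²η². Then for every c > 0: 2η ∑_{t=1}^{T} E_A[f_S(x_t) − f_S(x_*^S)] ≤ D_x + D_x η β^{1/2} T + L_f² η² T + (c/e)^c V η β^{−1/2−c} ∑_{t=1}^{T} t^{−c} + 2σ_J² η β^{1/2} T + L_f² η³ β^{−3/2} T. Consequently, for the averaged output A(S) = (1/T)∑_{t=1}^{T} x_t, by convexity E_A[f_S(A(S)) − f_S(x_*^S)] is at most the right-hand side divided by 2ηT. -/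
open MeasureTheory
open scoped ENNReal

lemma aux_grad {E : Type*} [NormedAddCommGroup E] [InnerProductSpace ℝ E] [CompleteSpace E]
    (g : E → ℝ) (hd : Differentiable ℝ g) (hc : ConvexOn ℝ Set.univ g) (a b : E) :
    g a - g b ≤ inner ℝ (gradient g a) (a - b) := by
  have h1 : HasDerivAt (fun s : ℝ => g (a + s • (b - a))) (inner ℝ (gradient g a) (b - a)) 0 := by
    have hg : HasFDerivAt g (fderiv ℝ g a) (a + (0 : ℝ) • (b - a)) := by
      simpa using (hd a).hasFDerivAt
    have hl : HasDerivAt (fun s : ℝ => a + s • (b - a)) (b - a) 0 := by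
      simpa using ((hasDerivAt_id (0 : ℝ)).smul_const (b - a)).const_add a
    have := hg.comp_hasDerivAt (0 : ℝ) hl
    have e : inner ℝ (gradient g a) (b - a) = fderiv ℝ g a (b - a) := by
      simp [gradient]
    rw [e]; exact this
  have h2 : ConvexOn ℝ Set.univ (fun s : ℝ => g (a + s • (b - a))) := by
    refine ⟨convex_univ, ?_⟩
    intro p _ q _ u w hu hw huw
    have := hc.2 (Set.mem_univ (a + p • (b - a))) (Set.mem_univ (a + q • (b - a))) hu hw huw
    obtain rfl : w = 1 - u := by linarith
    have e : a + (u * p + (1 - u) * q) • (b - a)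
        = u • (a + p • (b - a)) + (1 - u) • (a + q • (b - a)) := by module
    change g (a + (u * p + (1 - u) * q) • (b - a)) ≤ _
    rw [e]; exact this
  have h3 := h2.le_slope_of_hasDerivAt (Set.mem_univ (0 : ℝ)) (Set.mem_univ (1 : ℝ)) one_pos h1
  simp only [slope, sub_zero, inv_one, one_smul, zero_smul, add_zero, vsub_eq_sub, add_sub_cancel] at h3
  have h4 : inner ℝ (gradient g a) (a - b) = - inner ℝ (gradient g a) (b - a) := by
    rw [← inner_neg_right, neg_sub]
  rw [h4]; linarith

lemma aux_proj {E : Type*} [NormedAddCommGroup E] [NormedSpace ℝ E]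
    (r : ℝ) (hr : 0 ≤ r) (v : E) : ‖projBall r v‖ ≤ r := by
  unfold projBall
  split_ifs with h
  · exact h
  · push Not at h
    have : 0 < ‖v‖ := lt_of_le_of_lt hr h
    rw [norm_smul, Real.norm_eq_abs, abs_of_nonneg (by positivity)]
    rw [div_mul_cancel₀ _ this.ne']

lemma aux_exp (β c : ℝ) (hβ : 0 < β) (hβ1 : β < 1) (hc : 0 < c) (t : ℕ) (ht : 1 ≤ t) :
    (1 - β) ^ t ≤ (c / Real.exp 1) ^ c * β ^ (-c) * (t : ℝ) ^ (-c) := by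
  have ht' : (0 : ℝ) < t := by exact_mod_cast ht
  have h1 : (1 - β) ^ t ≤ Real.exp (-(β * t)) := by
    have h : 1 - β ≤ Real.exp (-β) := by linarith [Real.add_one_le_exp (-β)]
    calc (1 - β) ^ t ≤ (Real.exp (-β)) ^ t := pow_le_pow_left₀ (by linarith) h t
      _ = _ := by rw [← Real.exp_nat_mul]; congr 1; ring
  refine h1.trans ?_
  rw [Real.rpow_def_of_pos (by positivity), Real.rpow_def_of_pos hβ, Real.rpow_def_of_pos ht',
    ← Real.exp_add, ← Real.exp_add, Real.exp_le_exp,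
    Real.log_div hc.ne' (Real.exp_pos 1).ne', Real.log_exp]
  have h2 : Real.log (β * t / c) ≤ β * t / c - 1 := Real.log_le_sub_one_of_pos (by positivity)
  rw [Real.log_div (by positivity) hc.ne', Real.log_mul hβ.ne' ht'.ne'] at h2
  have h3 := mul_le_mul_of_nonneg_left h2 hc.le
  have h4 : c * (β * t / c - 1) = β * t - c := by field_simp
  rw [h4] at h3
  nlinarith

/-- pointwise one-step inequality -/
lemma aux_step {E : Type*} [NormedAddCommGroup E] [InnerProductSpace ℝ E]
    (η L r : ℝ) (hη : 0 < η) (hr : 0 < r) (y v g : E) (hv : ‖v‖ ≤ L) (δ : ℝ)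
    (hδ : δ ≤ inner ℝ g y) :
    2 * η * δ ≤ ‖y‖ ^ 2 - ‖y - η • v‖ ^ 2 + η * r * ‖y‖ ^ 2 + η * r⁻¹ * ‖v - g‖ ^ 2
      + L ^ 2 * η ^ 2 := by
  have h1 : ‖y - η • v‖ ^ 2 = ‖y‖ ^ 2 - 2 * η * inner ℝ v y + η ^ 2 * ‖v‖ ^ 2 := by
    rw [norm_sub_sq_real, inner_smul_right, norm_smul, Real.norm_eq_abs, mul_pow, sq_abs,
      real_inner_comm]
    ring
  have h2 : inner ℝ v y = inner ℝ g y + inner ℝ (v - g) y := by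
    rw [inner_sub_left]; ring
  have h3 : -(inner ℝ (v - g) y) ≤ ‖v - g‖ * ‖y‖ := by
    have := abs_le.1 (abs_real_inner_le_norm (v - g) y)
    linarith [this.1]
  have h4 : 2 * (‖v - g‖ * ‖y‖) ≤ r * ‖y‖ ^ 2 + r⁻¹ * ‖v - g‖ ^ 2 := by
    have : r * ‖y‖ ^ 2 + r⁻¹ * ‖v - g‖ ^ 2 - 2 * (‖v - g‖ * ‖y‖)
        = r⁻¹ * (r * ‖y‖ - ‖v - g‖) ^ 2 := by field_simp; ring
    have : 0 ≤ r⁻¹ * (r * ‖y‖ - ‖v - g‖) ^ 2 := by positivity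
    linarith
  have h5 : ‖v‖ ^ 2 ≤ L ^ 2 := pow_le_pow_left₀ (norm_nonneg _) hv 2
  have h6 : η ^ 2 * ‖v‖ ^ 2 ≤ η ^ 2 * L ^ 2 := by gcongr
  have h7 := mul_le_mul_of_nonneg_left (by linarith : 2 * (δ + inner ℝ (v - g) y) ≥ 2 * (δ - ‖v - g‖ * ‖y‖)) hη.le
  have h8 := mul_le_mul_of_nonneg_left h4 hη.le
  have h9 := mul_le_mul_of_nonneg_left hδ hη.le
  rw [h1, h2]
  nlinarith

/-- Optimization error of STORM in the convex one-level setting, together with the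
bound for the averaged output. -/
theorem stmt_7 (d n T : ℕ) (hn : 0 < n) (hT : 1 ≤ T)
    (Lf η β Dx V σJ : ℝ) (hη : 0 < η) (hη1 : η < 1) (hβ : 0 < β) (hβ1 : β < 1)
    (hσJ : 0 ≤ σJ)
    (f : Fin n → EuclideanSpace ℝ (Fin d) → ℝ)
    (hfdiff : ∀ i, Differentiable ℝ (f i))
    (hflip : ∀ i a b, |f i a - f i b| ≤ Lf * ‖a - b‖)
    (fS : EuclideanSpace ℝ (Fin d) → ℝ)
    (hfS : fS = fun x => (n : ℝ)⁻¹ * ∑ i, f i x)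
    (hconv : ConvexOn ℝ Set.univ fS)
    (xs : EuclideanSpace ℝ (Fin d)) (hxs : ∀ y, fS xs ≤ fS y)
    (Ω : Type) (instΩ : MeasurableSpace Ω) (P : Measure Ω) (hP : IsProbabilityMeasure P)
    (J : ℕ → Ω → Fin n)
    (hJmeas : ∀ t, Measurable (J t))
    (hJunif : ∀ t i, P {ω | J t ω = i} = (n : ℝ≥0∞)⁻¹)
    (hJindep : ∀ (s : Finset ℕ) (κ : ℕ → Fin n),
      P {ω | ∀ t ∈ s, J t ω = κ t} = ∏ t ∈ s, P {ω | J t ω = κ t})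
    (x v : ℕ → Ω → EuclideanSpace ℝ (Fin d))
    (x₀ v₀ : EuclideanSpace ℝ (Fin d)) (hv₀ : ‖v₀‖ ≤ Lf)
    (hx0 : ∀ ω, x 0 ω = x₀) (hv0 : ∀ ω, v 0 ω = v₀)
    (hxrec : ∀ t ω, x (t + 1) ω = x t ω - η • v t ω)
    (hvrec : ∀ t ω, v (t + 1) ω = projBall Lf
      (gradient (f (J (t + 1) ω)) (x (t + 1) ω)
        + (1 - β) • (v t ω - gradient (f (J (t + 1) ω)) (x t ω))))
    (hDx : ∀ t, 1 ≤ t → t ≤ T + 1 → ∫ ω, ‖x t ω - xs‖ ^ 2 ∂P ≤ Dx)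
    (hV : ∫ ω, ‖v 0 ω - gradient fS (x 0 ω)‖ ^ 2 ∂P ≤ V)
    (hrec : ∀ t, 1 ≤ t →
      ∫ ω, ‖v t ω - gradient fS (x t ω)‖ ^ 2 ∂P ≤
        (1 - β) * ∫ ω, ‖v (t - 1) ω - gradient fS (x (t - 1) ω)‖ ^ 2 ∂P
          + 2 * β ^ 2 * σJ ^ 2 + Lf ^ 2 * η ^ 2) :
    ∀ c : ℝ, 0 < c →
      (2 * η * ∑ t ∈ Finset.Icc 1 T, ∫ ω, (fS (x t ω) - fS xs) ∂P ≤
        Dx + Dx * η * β ^ ((1 : ℝ) / 2) * T + Lf ^ 2 * η ^ 2 * T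
          + (c / Real.exp 1) ^ c * V * η * β ^ (-(1 : ℝ) / 2 - c) *
              ∑ t ∈ Finset.Icc 1 T, (t : ℝ) ^ (-c)
          + 2 * σJ ^ 2 * η * β ^ ((1 : ℝ) / 2) * T
          + Lf ^ 2 * η ^ 3 * β ^ (-(3 : ℝ) / 2) * T) ∧
      (∫ ω, (fS ((T : ℝ)⁻¹ • ∑ t ∈ Finset.Icc 1 T, x t ω) - fS xs) ∂P ≤
        (Dx + Dx * η * β ^ ((1 : ℝ) / 2) * T + Lf ^ 2 * η ^ 2 * T
          + (c / Real.exp 1) ^ c * V * η * β ^ (-(1 : ℝ) / 2 - c) *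
              ∑ t ∈ Finset.Icc 1 T, (t : ℝ) ^ (-c)
          + 2 * σJ ^ 2 * η * β ^ ((1 : ℝ) / 2) * T
          + Lf ^ 2 * η ^ 3 * β ^ (-(3 : ℝ) / 2) * T) / (2 * η * T)) := by
  intro c hc
  have hL : 0 ≤ Lf := (norm_nonneg _).trans hv₀
  have hTpos : (0 : ℝ) < T := by exact_mod_cast hT
  have hfSd : Differentiable ℝ fS := by
    rw [hfS]
    exact (Differentiable.fun_sum (fun i _ => hfdiff i)).const_mul _
  -- simple functions
  have hsimple : ∀ t, ∃ s : SimpleFunc Ω (EuclideanSpace ℝ (Fin d) × EuclideanSpace ℝ (Fin d)),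
      ∀ ω, s ω = (x t ω, v t ω) := by
    intro t
    induction t with
    | zero => exact ⟨SimpleFunc.const Ω (x₀, v₀), fun ω => by simp [hx0, hv0]⟩
    | succ t ih =>
      obtain ⟨s, hs⟩ := ih
      let Js : SimpleFunc Ω (Fin n) :=
        ⟨J (t + 1), fun i => hJmeas (t + 1) (measurableSet_singleton i), Set.toFinite _⟩
      have hJs : ∀ ω, Js ω = J (t + 1) ω := fun ω => rfl
      refine ⟨(SimpleFunc.pair Js s).map (fun p => (p.2.1 - η • p.2.2,
        projBall Lf (gradient (f p.1) (p.2.1 - η • p.2.2)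
          + (1 - β) • (p.2.2 - gradient (f p.1) p.2.1)))), fun ω => ?_⟩
      simp only [SimpleFunc.map_apply, SimpleFunc.pair_apply, hs, hJs, hvrec, hxrec]
  choose s hs using hsimple
  have hint : ∀ (t : ℕ) (F : EuclideanSpace ℝ (Fin d) → EuclideanSpace ℝ (Fin d) → ℝ),
      Integrable (fun ω => F (x t ω) (v t ω)) P := by
    intro t F
    have := ((s t).map (fun p => F p.1 p.2)).integrable_of_isFiniteMeasure (μ := P)
    refine this.congr (Filter.Eventually.of_forall fun ω => ?_)
    simp [hs]
  have hvn : ∀ t ω, ‖v t ω‖ ≤ Lf := by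
    intro t ω
    cases t with
    | zero => rw [hv0]; exact hv₀
    | succ t => rw [hvrec]; exact aux_proj Lf hL _
  set e : ℕ → ℝ := fun t => ∫ ω, ‖v t ω - gradient fS (x t ω)‖ ^ 2 ∂P with he
  set a : ℕ → ℝ := fun t => ∫ ω, ‖x t ω - xs‖ ^ 2 ∂P with ha
  set r : ℝ := β ^ ((1 : ℝ) / 2) with hr
  have hrpos : 0 < r := Real.rpow_pos_of_pos hβ _
  have hV0 : 0 ≤ V := le_trans (integral_nonneg fun ω => by positivity) hV
  have hr2 : r * r = β := by
    rw [hr, ← Real.rpow_add hβ]; norm_num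
  have hrinv : β ^ (-(1 : ℝ) / 2) = r⁻¹ := by
    rw [hr, ← Real.rpow_neg hβ.le]; norm_num
  have hb1 : β ^ (-(1 : ℝ) / 2 - c) = r⁻¹ * β ^ (-c) := by
    rw [← hrinv, ← Real.rpow_add hβ]; ring_nf
  have hb3 : β ^ (-(3 : ℝ) / 2) = r⁻¹ * β⁻¹ := by
    rw [← hrinv, ← Real.rpow_neg_one β, ← Real.rpow_add hβ]; norm_num
  -- the recursion solved
  have het : ∀ t, e t ≤ (1 - β) ^ t * V + (2 * β * σJ ^ 2 + Lf ^ 2 * η ^ 2 * β⁻¹) := by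
    intro t
    induction t with
    | zero =>
      have : 0 ≤ 2 * β * σJ ^ 2 + Lf ^ 2 * η ^ 2 * β⁻¹ := by positivity
      have h0 : e 0 ≤ V := hV
      simp only [pow_zero, one_mul]
      linarith
    | succ t ih =>
      have h1 : e (t + 1) ≤ (1 - β) * e t + 2 * β ^ 2 * σJ ^ 2 + Lf ^ 2 * η ^ 2 := by
        simpa using hrec (t + 1) (by omega)
      have h2 := mul_le_mul_of_nonneg_left ih (by linarith : (0 : ℝ) ≤ 1 - β)
      have h3 : (1 - β) * ((1 - β) ^ t * V + (2 * β * σJ ^ 2 + Lf ^ 2 * η ^ 2 * β⁻¹))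
          + 2 * β ^ 2 * σJ ^ 2 + Lf ^ 2 * η ^ 2
          = (1 - β) ^ (t + 1) * V + (2 * β * σJ ^ 2 + Lf ^ 2 * η ^ 2 * β⁻¹) := by
        field_simp
        ring
      linarith
  set K : ℝ := (c / Real.exp 1) ^ c * β ^ (-c) with hK
  -- one step
  have hstep : ∀ t, 2 * η * ∫ ω, (fS (x t ω) - fS xs) ∂P ≤
      a t - a (t + 1) + η * r * a t + η * r⁻¹ * e t + Lf ^ 2 * η ^ 2 := by
    intro t
    have i1 : Integrable (fun ω => ‖x t ω - xs‖ ^ 2) P := hint t fun y _ => ‖y - xs‖ ^ 2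
    have i2 : Integrable (fun ω => ‖x (t + 1) ω - xs‖ ^ 2) P :=
      hint (t + 1) fun y _ => ‖y - xs‖ ^ 2
    have i3 : Integrable (fun ω => ‖v t ω - gradient fS (x t ω)‖ ^ 2) P :=
      hint t fun y w => ‖w - gradient fS y‖ ^ 2
    have i4 : Integrable (fun ω => fS (x t ω) - fS xs) P := hint t fun y _ => fS y - fS xs
    have hm : ∫ ω, 2 * η * (fS (x t ω) - fS xs) ∂P ≤
        ∫ ω, (‖x t ω - xs‖ ^ 2 - ‖x (t + 1) ω - xs‖ ^ 2 + η * r * ‖x t ω - xs‖ ^ 2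
          + η * r⁻¹ * ‖v t ω - gradient fS (x t ω)‖ ^ 2 + Lf ^ 2 * η ^ 2) ∂P := by
      refine integral_mono (i4.const_mul _) ((((i1.sub i2).add (i1.const_mul _)).add
        (i3.const_mul _)).add (integrable_const _)) fun ω => ?_
      have h := aux_step η Lf r hη hrpos (x t ω - xs) (v t ω) (gradient fS (x t ω)) (hvn t ω)
        (fS (x t ω) - fS xs) (aux_grad fS hfSd hconv _ _)
      have h' : x t ω - xs - η • v t ω = x (t + 1) ω - xs := by rw [hxrec]; abel
      rw [h'] at h
      exact h
    have j1 : Integrable (fun ω => ‖x t ω - xs‖ ^ 2 - ‖x (t + 1) ω - xs‖ ^ 2) P := i1.sub i2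
    have j2 : Integrable (fun ω => ‖x t ω - xs‖ ^ 2 - ‖x (t + 1) ω - xs‖ ^ 2
        + η * r * ‖x t ω - xs‖ ^ 2) P := j1.add (i1.const_mul _)
    have j3 : Integrable (fun ω => ‖x t ω - xs‖ ^ 2 - ‖x (t + 1) ω - xs‖ ^ 2
        + η * r * ‖x t ω - xs‖ ^ 2 + η * r⁻¹ * ‖v t ω - gradient fS (x t ω)‖ ^ 2) P :=
      j2.add (i3.const_mul _)
    rw [integral_const_mul, integral_add j3 (integrable_const _),
      integral_add j2 (i3.const_mul _), integral_add j1 (i1.const_mul _), integral_sub i1 i2,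
      integral_const_mul, integral_const_mul] at hm
    simpa using hm
  have hsum : ∀ N, N ≤ T → 2 * η * ∑ t ∈ Finset.Icc 1 N, ∫ ω, (fS (x t ω) - fS xs) ∂P ≤
      a 1 - a (N + 1) + (Dx * η * r + Lf ^ 2 * η ^ 2 + η * r⁻¹ *
        (2 * β * σJ ^ 2 + Lf ^ 2 * η ^ 2 * β⁻¹)) * N
        + K * V * η * r⁻¹ * ∑ t ∈ Finset.Icc 1 N, (t : ℝ) ^ (-c) := by
    intro N
    induction N with
    | zero => intro _; simp
    | succ N ih =>
      intro hN
      have h1 := ih (by omega)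
      have h2 := hstep (N + 1)
      have h3 : η * r * a (N + 1) ≤ η * r * Dx :=
        mul_le_mul_of_nonneg_left (hDx (N + 1) (by omega) (by omega)) (by positivity)
      have h4 := aux_exp β c hβ hβ1 hc (N + 1) (by omega)
      have h5 : e (N + 1) ≤ K * ((N + 1 : ℕ) : ℝ) ^ (-c) * V
          + (2 * β * σJ ^ 2 + Lf ^ 2 * η ^ 2 * β⁻¹) :=
        (het (N + 1)).trans (by gcongr)
      have h6 := mul_le_mul_of_nonneg_left h5 (by positivity : 0 ≤ η * r⁻¹)
      rw [Finset.sum_Icc_succ_top (by omega), Finset.sum_Icc_succ_top (by omega), mul_add, mul_add]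
      push_cast at *
      linarith
  have ha1 : a 1 ≤ Dx := hDx 1 le_rfl (by omega)
  have haT : 0 ≤ a (T + 1) := integral_nonneg fun ω => by positivity
  have hmain : 2 * η * ∑ t ∈ Finset.Icc 1 T, ∫ ω, (fS (x t ω) - fS xs) ∂P ≤
        Dx + Dx * η * r * T + Lf ^ 2 * η ^ 2 * T
          + (c / Real.exp 1) ^ c * V * η * β ^ (-(1 : ℝ) / 2 - c) *
              ∑ t ∈ Finset.Icc 1 T, (t : ℝ) ^ (-c)
          + 2 * σJ ^ 2 * η * r * T
          + Lf ^ 2 * η ^ 3 * β ^ (-(3 : ℝ) / 2) * T := by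
    have h := hsum T le_rfl
    have hrb : r⁻¹ * β = r := by rw [← hr2]; field_simp
    rw [hb1, hb3]
    have e1 : (Dx * η * r + Lf ^ 2 * η ^ 2 + η * r⁻¹ *
        (2 * β * σJ ^ 2 + Lf ^ 2 * η ^ 2 * β⁻¹)) * T = Dx * η * r * T + Lf ^ 2 * η ^ 2 * T
        + 2 * σJ ^ 2 * η * (r⁻¹ * β) * T + Lf ^ 2 * η ^ 3 * (r⁻¹ * β⁻¹) * T := by ring
    have e2 : K * V * η * r⁻¹ * ∑ t ∈ Finset.Icc 1 T, (t : ℝ) ^ (-c)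
      = (c / Real.exp 1) ^ c * V * η * (r⁻¹ * β ^ (-c)) *
              ∑ t ∈ Finset.Icc 1 T, (t : ℝ) ^ (-c) := by rw [hK]; ring
    rw [e1, e2, hrb] at h
    linarith
  refine ⟨hmain, ?_⟩
  rw [le_div_iff₀ (by positivity)]
  refine le_trans ?_ hmain
  -- Jensen
  have hjen : ∫ ω, (fS ((T : ℝ)⁻¹ • ∑ t ∈ Finset.Icc 1 T, x t ω) - fS xs) ∂P ≤
      (T : ℝ)⁻¹ * ∑ t ∈ Finset.Icc 1 T, ∫ ω, (fS (x t ω) - fS xs) ∂P := by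
    have i4 : ∀ t ∈ Finset.Icc 1 T, Integrable (fun ω => fS (x t ω) - fS xs) P :=
      fun t _ => hint t fun y _ => fS y - fS xs
    rw [← integral_finsetSum _ i4, ← integral_const_mul]
    have hpt : ∀ ω, fS ((T : ℝ)⁻¹ • ∑ t ∈ Finset.Icc 1 T, x t ω) - fS xs ≤
        (T : ℝ)⁻¹ * ∑ t ∈ Finset.Icc 1 T, (fS (x t ω) - fS xs) := by
      intro ω
      have h := hconv.map_sum_le (t := Finset.Icc 1 T) (w := fun _ => (T : ℝ)⁻¹)
        (p := fun t => x t ω) (fun _ _ => by positivity) (by simp [hTpos.ne'])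
        (fun _ _ => Set.mem_univ _)
      rw [← Finset.smul_sum, ← Finset.smul_sum] at h
      rw [Finset.sum_sub_distrib, mul_sub]
      simp only [Finset.sum_const, Nat.card_Icc, Nat.add_sub_cancel, nsmul_eq_mul, smul_eq_mul]
        at h ⊢
      rw [inv_mul_cancel_left₀ hTpos.ne']
      linarith
    refine integral_mono_of_nonneg (Filter.Eventually.of_forall fun ω => ?_)
      ((integrable_finsetSum _ i4).const_mul _) (Filter.Eventually.of_forall hpt)
    exact sub_nonneg.2 (hxs _)
  calc _ ≤ ((T : ℝ)⁻¹ * ∑ t ∈ Finset.Icc 1 T, ∫ ω, (fS (x t ω) - fS xs) ∂P) * (2 * η * T) :=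
        mul_le_mul_of_nonneg_right hjen (by positivity)
    _ = _ := by field_simp
end

section
/- Let (u_t)_{t≥0} be a sequence of non-negative real numbers, (S_t)_{t≥0} a non-decreasing sequence of non-negative real numbers with S_0 ≥ u_0², and (α_τ)_{τ≥1} non-negative real numbers. Assume that for every t ≥ 0, u_t² ≤ S_t + ∑_{τ=1}^{t−1} α_τ u_τ. Then for every t ≥ 0, u_t ≤ √(S_t) + ∑_{τ=1}^{t−1} α_τ. -/
/-- Recursion lemma: if `u t ^ 2 ≤ S t + ∑_{τ=1}^{t-1} α τ * u τ` with `S` non-decreasing,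
`S 0 ≥ u 0 ^ 2`, and all quantities non-negative, then `u t ≤ √(S t) + ∑_{τ=1}^{t-1} α τ`. -/
theorem stmt_12 (u S α : ℕ → ℝ)
    (hu : ∀ t, 0 ≤ u t)
    (hS : ∀ s t, s ≤ t → S s ≤ S t)
    (hSnonneg : ∀ t, 0 ≤ S t)
    (hS0 : u 0 ^ 2 ≤ S 0)
    (hα : ∀ τ, 0 ≤ α τ)
    (h : ∀ t, u t ^ 2 ≤ S t + ∑ τ ∈ Finset.Ico 1 t, α τ * u τ) :
    ∀ t, u t ≤ Real.sqrt (S t) + ∑ τ ∈ Finset.Ico 1 t, α τ := by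
  intro t
  induction t using Nat.strong_induction_on with
  | _ t ih =>
    have hA : 0 ≤ ∑ τ ∈ Finset.Ico 1 t, α τ := Finset.sum_nonneg fun i _ => hα i
    have hs : 0 ≤ Real.sqrt (S t) := Real.sqrt_nonneg _
    have hsq : Real.sqrt (S t) ^ 2 = S t := Real.sq_sqrt (hSnonneg t)
    have key : ∑ τ ∈ Finset.Ico 1 t, α τ * u τ ≤
        (∑ τ ∈ Finset.Ico 1 t, α τ) * (Real.sqrt (S t) + ∑ τ ∈ Finset.Ico 1 t, α τ) := by
      rw [Finset.sum_mul]
      refine Finset.sum_le_sum fun i hi => mul_le_mul_of_nonneg_left ?_ (hα i)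
      have hit : i < t := (Finset.mem_Ico.mp hi).2
      refine (ih i hit).trans (add_le_add (Real.sqrt_le_sqrt (hS i t hit.le)) ?_)
      exact Finset.sum_le_sum_of_subset_of_nonneg
        (Finset.Ico_subset_Ico_right hit.le) fun j _ _ => hα j
    refine (sq_le_sq₀ (hu t) (add_nonneg hs hA)).mp ?_
    nlinarith [h t, mul_nonneg hs hA]
end

section
/- Let β ∈ (0,1), σ ≥ 0, D ≥ 0, and let (a_t)_{t≥0} be a sequence of non-negative real numbers satisfying a_t ≤ (1 − β) a_{t−1} + 2β²σ² + D for all t ≥ 1. Then for every c > 0 and every integer t ≥ 1: a_t ≤ (c/e)^c (tβ)^{−c} a_0 + 2βσ² + D/β. -/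
/-- Contraction-plus-noise estimate: if `a t ≤ (1-β) a (t-1) + 2β²σ² + D` then for any `c > 0`
and `t ≥ 1`, `a t ≤ (c/e)^c (tβ)^{-c} a 0 + 2βσ² + D/β`. -/
theorem stmt_13 (β σ D : ℝ) (hβ : β ∈ Set.Ioo (0 : ℝ) 1) (hσ : 0 ≤ σ) (hD : 0 ≤ D)
    (a : ℕ → ℝ) (ha : ∀ t, 0 ≤ a t)
    (hrec : ∀ t, 1 ≤ t → a t ≤ (1 - β) * a (t - 1) + 2 * β ^ 2 * σ ^ 2 + D) :
    ∀ c : ℝ, 0 < c → ∀ t : ℕ, 1 ≤ t →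
      a t ≤ (c / Real.exp 1) ^ c * ((t : ℝ) * β) ^ (-c) * a 0 + 2 * β * σ ^ 2 + D / β := by
  obtain ⟨h0, h1⟩ := hβ
  intro c hc t ht
  have key : ∀ n : ℕ, a n ≤ (1 - β) ^ n * a 0 + (2 * β * σ ^ 2 + D / β) := by
    intro n
    induction n with
    | zero =>
      have : 0 ≤ 2 * β * σ ^ 2 + D / β := by positivity
      simpa using this
    | succ k ih =>
      have h := hrec (k + 1) (by omega)
      rw [Nat.add_sub_cancel] at h
      have h2 := mul_le_mul_of_nonneg_left ih (by linarith : 0 ≤ 1 - β)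
      have h3 : (1 - β) * ((1 - β) ^ k * a 0 + (2 * β * σ ^ 2 + D / β))
          + 2 * β ^ 2 * σ ^ 2 + D
          = (1 - β) ^ (k + 1) * a 0 + (2 * β * σ ^ 2 + D / β) := by
        field_simp
        ring
      linarith
  have ht' : (0 : ℝ) < t := by exact_mod_cast ht
  have hx : 0 < (t : ℝ) * β := by positivity
  have hpow : (1 - β) ^ t ≤ Real.exp (-((t : ℝ) * β)) := by
    have h := pow_le_pow_left₀ (by linarith : 0 ≤ 1 - β) (Real.one_sub_le_exp_neg β) t
    rw [← Real.exp_nat_mul] at h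
    rwa [mul_neg] at h
  have hexp : Real.exp (-((t : ℝ) * β)) ≤ (c / Real.exp 1) ^ c * ((t : ℝ) * β) ^ (-c) := by
    rw [Real.rpow_def_of_pos (by positivity), Real.rpow_def_of_pos hx, ← Real.exp_add,
      Real.exp_le_exp, Real.log_div hc.ne' (Real.exp_pos 1).ne', Real.log_exp]
    have h := Real.log_le_sub_one_of_pos (div_pos hx hc)
    rw [Real.log_div hx.ne' hc.ne'] at h
    have h2 := mul_le_mul_of_nonneg_left h hc.le
    have h3 : c * ((t : ℝ) * β / c - 1) = (t : ℝ) * β - c := by field_simp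
    rw [h3] at h2
    linarith
  have := mul_le_mul_of_nonneg_right (hpow.trans hexp) (ha 0)
  linarith [key t]
end

section
/- Let F : ℝ^d → ℝ be convex and differentiable, let x, x̄, v ∈ ℝ^d with ‖v‖ ≤ L_f, and let η > 0, γ > 0. Then the biased-gradient step x⁺ = x − η v satisfies ‖x⁺ − x̄‖² ≤ (1 + ηγ) ‖x − x̄‖² − 2η ( F(x) − F(x̄) ) + η² L_f² + (η/γ) ‖∇F(x) − v‖². -/
theorem convex_grad_ineq {d : ℕ} (F : EuclideanSpace ℝ (Fin d) → ℝ)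
    (hFconv : ConvexOn ℝ Set.univ F) (hFdiff : Differentiable ℝ F)
    (x y : EuclideanSpace ℝ (Fin d)) :
    F x + inner ℝ (gradient F x) (y - x) ≤ F y := by
  have hg : ConvexOn ℝ Set.univ (fun t : ℝ => F (AffineMap.lineMap x y t)) :=
    hFconv.comp_affineMap (AffineMap.lineMap x y)
  have hF : HasFDerivAt F (fderiv ℝ F x) (AffineMap.lineMap x y (0 : ℝ)) := by
    simpa using (hFdiff x).hasFDerivAt
  have hd : HasDerivAt (fun t : ℝ => F (AffineMap.lineMap x y t)) (fderiv ℝ F x (y - x)) 0 :=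
    hF.comp_hasDerivAt (0 : ℝ) AffineMap.hasDerivAt_lineMap
  have h := hg.le_slope_of_hasDerivAt (Set.mem_univ 0) (Set.mem_univ 1) one_pos hd
  have e : inner ℝ (gradient F x) (y - x) = fderiv ℝ F x (y - x) := by
    simp [gradient]
  rw [e]
  simp [slope_def_field] at h
  simp
  linarith

/-- One-step progress inequality for a biased-gradient step on a convex function. -/
theorem stmt_14 {d : ℕ} (F : EuclideanSpace ℝ (Fin d) → ℝ)
    (hFconv : ConvexOn ℝ Set.univ F) (hFdiff : Differentiable ℝ F)
    (Lf η γ : ℝ) (hη : 0 < η) (hγ : 0 < γ)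
    (x xb v : EuclideanSpace ℝ (Fin d)) (hv : ‖v‖ ≤ Lf) :
    ‖x - η • v - xb‖ ^ 2 ≤
      (1 + η * γ) * ‖x - xb‖ ^ 2 - 2 * η * (F x - F xb) + η ^ 2 * Lf ^ 2
        + (η / γ) * ‖gradient F x - v‖ ^ 2 := by
  have h1 := convex_grad_ineq F hFconv hFdiff x xb
  have e1 : inner ℝ (gradient F x) (xb - x) = - inner ℝ (x - xb) (gradient F x) := by
    rw [real_inner_comm, ← inner_neg_left, neg_sub]
  have e2 : ‖x - η • v - xb‖ ^ 2
      = ‖x - xb‖ ^ 2 - 2 * (η * inner ℝ (x - xb) v) + η ^ 2 * ‖v‖ ^ 2 := by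
    rw [show x - η • v - xb = (x - xb) - η • v by abel, norm_sub_sq_real,
      real_inner_smul_right, norm_smul, mul_pow, Real.norm_eq_abs, sq_abs]
  have h3 : ‖v‖ ^ 2 ≤ Lf ^ 2 := pow_le_pow_left₀ (norm_nonneg v) hv 2
  have h4 := real_inner_le_norm (x - xb) (gradient F x - v)
  rw [inner_sub_right] at h4
  rw [e1] at h1
  rw [e2]
  set a := ‖x - xb‖
  set b := ‖gradient F x - v‖
  have h5 : 2 * (a * b) ≤ γ * a ^ 2 + b ^ 2 / γ := by
    have : γ * a ^ 2 + b ^ 2 / γ - 2 * (a * b) = (γ * a - b) ^ 2 / γ := by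
      field_simp
      ring
    have : 0 ≤ (γ * a - b) ^ 2 / γ := by positivity
    linarith
  have h6 : η ^ 2 * ‖v‖ ^ 2 ≤ η ^ 2 * Lf ^ 2 := by gcongr
  have h7 : -2 * inner ℝ (x - xb) v ≤ γ * a ^ 2 + b ^ 2 / γ - 2 * (F x - F xb) := by
    linarith
  have h8 := mul_le_mul_of_nonneg_left h7 hη.le
  have e3 : η / γ * b ^ 2 = η * (b ^ 2 / γ) := by ring
  rw [e3]
  linarith
end

section
/- Let K ≥ 1, L_f ≥ 1, and for k = 1,…,K let f_k : ℝ^{d_{k−1}} → ℝ^{d_k} (with d_0 = d, d_K = 1) be differentiable, L_f-Lipschitz, with L_f-Lipschitz derivative; write ∇f_k(y) for the transpose of the Jacobian of f_k at y, so that F = f_K ∘ ⋯ ∘ f_1 has gradient ∇F(x) = ∇f_1(x)·∇f_2(f_1(x))⋯∇f_K(f_{K−1}∘⋯∘f_1(x)) ∈ ℝ^d, and assume F is convex. Let x, x̄ ∈ ℝ^d, set u^{(0)} = x, let u^{(i)} ∈ ℝ^{d_i} for i = 1,…,K−1, let v^{(i)} be matrices of the same shapes as the ∇f_i with Frobenius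 norms ‖v^{(i)}‖ ≤ L_f, and let η > 0, γ > 0, λ > 0. Then ‖ x − η ∏_{i=1}^{K} v^{(i)} − x̄ ‖² ≤ ‖x − x̄‖² + L_f^{2K} η² − 2η ( F(x) − F(x̄) ) + γη ( ∑_{i=1}^{K} ∑_{j=1}^{i−1} L_f^{K−j+i(i−1)/2} ) ‖x − x̄‖² + (η/γ) ∑_{i=1}^{K} ∑_{j=1}^{i−1} L_f^{K−j+i(i−1)/2} ‖u^{(j)} − f_j(u^{(j−1)})‖² + λη ( ∑_{i=1}^{K} L_f^{K−i+i(i−1)/2} ) ‖x − x̄‖² + (η/λ) ∑_{i=1}^{K} L_f^{K−i+i(i−1)/2} ‖v^{(i)} − ∇f_i(u^{(i−1)})‖². -/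
/-- Frobenius norm of a real matrix. -/
noncomputable def frobNorm {a b : ℕ} (M : Matrix (Fin a) (Fin b) ℝ) : ℝ :=
  Real.sqrt (∑ i, ∑ j, (M i j) ^ 2)

/-- Composition `g (k-1) ∘ ⋯ ∘ g 0` of a chain of maps. -/
def chainComp {E : ℕ → Type*} (g : (k : ℕ) → E k → E (k + 1)) : (k : ℕ) → E 0 → E k
  | 0 => fun x => x
  | k + 1 => fun x => g k (chainComp g k x)

/-- Ordered product `v 0 * v 1 * ⋯ * v (k-1)` of a chain of matrices. -/
noncomputable def matChainProd (dd : ℕ → ℕ)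
    (v : (i : ℕ) → Matrix (Fin (dd i)) (Fin (dd (i + 1))) ℝ) :
    (k : ℕ) → Matrix (Fin (dd 0)) (Fin (dd k)) ℝ
  | 0 => 1
  | k + 1 => matChainProd dd v k * v k

/-- Identification of a `d × 1` matrix (here a `d × dd K` matrix with `dd K = 1`)
with a Euclidean vector. -/
noncomputable def toVec {a b : ℕ} (M : Matrix (Fin a) (Fin b) ℝ) :
    EuclideanSpace ℝ (Fin a) :=
  (EuclideanSpace.equiv (Fin a) ℝ).symm fun i => ∑ j, M i j

/-- Identification of a vector in a `1`-dimensional Euclidean space with a real number. -/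
noncomputable def toScalar {b : ℕ} (y : EuclideanSpace ℝ (Fin b)) : ℝ :=
  ∑ j, EuclideanSpace.equiv (Fin b) ℝ y j

theorem frobNorm_nonneg' {a b : ℕ} (M : Matrix (Fin a) (Fin b) ℝ) : 0 ≤ frobNorm M :=
  Real.sqrt_nonneg _

theorem frob_apply_le {a b : ℕ} (M : Matrix (Fin a) (Fin b) ℝ) (w : EuclideanSpace ℝ (Fin b)) :
    ‖Matrix.toEuclideanLin M w‖ ≤ frobNorm M * ‖w‖ := by
  rw [EuclideanSpace.norm_eq, EuclideanSpace.norm_eq, frobNorm,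
    ← Real.sqrt_mul (by positivity)]
  apply Real.sqrt_le_sqrt
  rw [Finset.sum_mul]
  refine Finset.sum_le_sum fun i _ => ?_
  have h := Finset.sum_mul_sq_le_sq_mul_sq Finset.univ (fun j => M i j) (fun j => w j)
  simpa [Matrix.toLpLin_apply, Matrix.mulVec, dotProduct] using h

theorem frobNorm_add_le {a b : ℕ} (M N : Matrix (Fin a) (Fin b) ℝ) :
    frobNorm (M + N) ≤ frobNorm M + frobNorm N := by
  have key : ∀ M : Matrix (Fin a) (Fin b) ℝ, frobNorm M =
      ‖(WithLp.toLp 2 (fun p : Fin a × Fin b => M p.1 p.2) :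
        EuclideanSpace ℝ (Fin a × Fin b))‖ := by
    intro M
    rw [EuclideanSpace.norm_eq, frobNorm, Fintype.sum_prod_type]
    simp
  rw [key, key, key]
  exact norm_add_le
    (WithLp.toLp 2 (fun p : Fin a × Fin b => M p.1 p.2) : EuclideanSpace ℝ (Fin a × Fin b))
    (WithLp.toLp 2 (fun p : Fin a × Fin b => N p.1 p.2) : EuclideanSpace ℝ (Fin a × Fin b))

theorem chain_bound (dd : ℕ → ℕ) (Lf : ℝ) (hLf : 1 ≤ Lf)
    (v : (i : ℕ) → Matrix (Fin (dd i)) (Fin (dd (i + 1))) ℝ) (k : ℕ)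
    (hv : ∀ i, i < k → frobNorm (v i) ≤ Lf) (w : EuclideanSpace ℝ (Fin (dd k))) :
    ‖Matrix.toEuclideanLin (matChainProd dd v k) w‖ ≤ Lf ^ k * ‖w‖ := by
  induction k with
  | zero => simp [matChainProd, Matrix.toLpLin_apply]
  | succ k ih =>
    have e : Matrix.toEuclideanLin (matChainProd dd v (k+1)) w
        = Matrix.toEuclideanLin (matChainProd dd v k) (Matrix.toEuclideanLin (v k) w) := by
      simp [matChainProd, Matrix.toLpLin_apply]
    rw [e]
    have h1 := ih (fun i hi => hv i (by omega)) (Matrix.toEuclideanLin (v k) w)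
    have h2 := frob_apply_le (v k) w
    have h3 : frobNorm (v k) * ‖w‖ ≤ Lf * ‖w‖ :=
      mul_le_mul_of_nonneg_right (hv k (by omega)) (norm_nonneg _)
    calc _ ≤ _ := h1
      _ ≤ Lf ^ k * (Lf * ‖w‖) := by gcongr; exact h2.trans h3
      _ = _ := by ring

theorem chain_diff (dd : ℕ → ℕ) (Lf : ℝ) (hLf : 1 ≤ Lf)
    (v g : (i : ℕ) → Matrix (Fin (dd i)) (Fin (dd (i + 1))) ℝ) (k : ℕ)
    (hv : ∀ i, i < k → frobNorm (v i) ≤ Lf)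
    (hg : ∀ i, i < k → ∀ w, ‖Matrix.toEuclideanLin (g i) w‖ ≤ Lf * ‖w‖)
    (w : EuclideanSpace ℝ (Fin (dd k))) :
    Lf * ‖Matrix.toEuclideanLin (matChainProd dd v k) w
      - Matrix.toEuclideanLin (matChainProd dd g k) w‖
      ≤ Lf ^ k * (∑ i ∈ Finset.range k, frobNorm (v i - g i)) * ‖w‖ := by
  induction k with
  | zero => simp [matChainProd]
  | succ k ih =>
    have e : ∀ v : (i : ℕ) → Matrix (Fin (dd i)) (Fin (dd (i + 1))) ℝ,
        Matrix.toEuclideanLin (matChainProd dd v (k+1)) w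
        = Matrix.toEuclideanLin (matChainProd dd v k) (Matrix.toEuclideanLin (v k) w) := by
      intro v
      simp [matChainProd, Matrix.toLpLin_apply]
    rw [e v, e g]
    have h1 := ih (fun i hi => hv i (by omega)) (fun i hi => hg i (by omega))
      (Matrix.toEuclideanLin (g k) w)
    have h2 := frob_apply_le (v k - g k) w
    have h3 := chain_bound dd Lf hLf v k (fun i hi => hv i (by omega))
      (Matrix.toEuclideanLin (v k - g k) w)
    have h4 := hg k (by omega) w
    have hs : 0 ≤ ∑ i ∈ Finset.range k, frobNorm (v i - g i) :=
      Finset.sum_nonneg fun i _ => frobNorm_nonneg' _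
    have e2 : Matrix.toEuclideanLin (matChainProd dd v k) (Matrix.toEuclideanLin (v k) w)
        - Matrix.toEuclideanLin (matChainProd dd g k) (Matrix.toEuclideanLin (g k) w)
        = Matrix.toEuclideanLin (matChainProd dd v k) (Matrix.toEuclideanLin (v k - g k) w)
        + (Matrix.toEuclideanLin (matChainProd dd v k) (Matrix.toEuclideanLin (g k) w)
          - Matrix.toEuclideanLin (matChainProd dd g k) (Matrix.toEuclideanLin (g k) w)) := by
      rw [map_sub, LinearMap.sub_apply, map_sub]; abel
    rw [e2, Finset.sum_range_succ]
    have hL : 0 ≤ Lf := by linarith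
    calc _ ≤ Lf * (Lf ^ k * (frobNorm (v k - g k) * ‖w‖))
          + Lf ^ k * (∑ i ∈ Finset.range k, frobNorm (v i - g i)) * (Lf * ‖w‖) := by
            refine (mul_le_mul_of_nonneg_left (norm_add_le _ _) hL).trans ?_
            rw [mul_add]
            refine add_le_add ?_ ?_
            · refine mul_le_mul_of_nonneg_left (h3.trans ?_) hL
              gcongr
            · refine h1.trans ?_
              gcongr
      _ = _ := by ring

theorem chain_deriv (dd : ℕ → ℕ)
    (f : (k : ℕ) → EuclideanSpace ℝ (Fin (dd k)) → EuclideanSpace ℝ (Fin (dd (k + 1))))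
    (Df : (k : ℕ) → EuclideanSpace ℝ (Fin (dd k)) → Matrix (Fin (dd k)) (Fin (dd (k + 1))) ℝ)
    (x : EuclideanSpace ℝ (Fin (dd 0))) (k : ℕ)
    (hfdiff : ∀ i, i < k → Differentiable ℝ (f i))
    (hDf : ∀ i, i < k → ∀ y, Matrix.toEuclideanLin (Df i y)
        = (ContinuousLinearMap.adjoint (fderiv ℝ (f i) y)).toLinearMap) :
    ∃ L : EuclideanSpace ℝ (Fin (dd 0)) →L[ℝ] EuclideanSpace ℝ (Fin (dd k)),
      HasFDerivAt (chainComp (E := fun k => EuclideanSpace ℝ (Fin (dd k))) f k) L x ∧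
      ∀ w h, inner ℝ (Matrix.toEuclideanLin (matChainProd dd
        (fun i => Df i (chainComp (E := fun k => EuclideanSpace ℝ (Fin (dd k))) f i x)) k) w) h
        = inner ℝ w (L h) := by
  induction k with
  | zero =>
    refine ⟨ContinuousLinearMap.id ℝ _, hasFDerivAt_id x, ?_⟩
    intro w h
    simp [matChainProd, Matrix.toLpLin_apply]
  | succ k ih =>
    obtain ⟨L, hL, hw⟩ := ih (fun i hi => hfdiff i (by omega)) (fun i hi => hDf i (by omega))
    refine ⟨(fderiv ℝ (f k) (chainComp (E := fun k => EuclideanSpace ℝ (Fin (dd k))) f k x)).comp L,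
      ?_, ?_⟩
    · exact (hfdiff k (by omega) _).hasFDerivAt.comp x hL
    · intro w h
      have e : ∀ v : (i : ℕ) → Matrix (Fin (dd i)) (Fin (dd (i + 1))) ℝ,
          Matrix.toEuclideanLin (matChainProd dd v (k+1)) w
          = Matrix.toEuclideanLin (matChainProd dd v k) (Matrix.toEuclideanLin (v k) w) := by
        intro v
        simp [matChainProd, Matrix.toLpLin_apply]
      rw [e, hw, hDf k (by omega)]
      simp [ContinuousLinearMap.adjoint_inner_left]

theorem convex_grad {E : Type*} [NormedAddCommGroup E] [NormedSpace ℝ E] (F : E → ℝ)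
    (hF : ConvexOn ℝ Set.univ F) (x y : E) (L : E →L[ℝ] ℝ) (hL : HasFDerivAt F L x) :
    F x - F y ≤ L (x - y) := by
  have hg : ConvexOn ℝ Set.univ (F ∘ (AffineMap.lineMap x y : ℝ →ᵃ[ℝ] E)) := by
    simpa using hF.comp_affineMap (AffineMap.lineMap x y : ℝ →ᵃ[ℝ] E)
  have hd : HasDerivAt (F ∘ (AffineMap.lineMap x y : ℝ →ᵃ[ℝ] E)) (L (y - x)) 0 := by
    have h0 : HasDerivAt (AffineMap.lineMap x y : ℝ →ᵃ[ℝ] E) (y - x) (0:ℝ) :=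
      AffineMap.hasDerivAt_lineMap
    refine HasFDerivAt.comp_hasDerivAt (0:ℝ) ?_ h0
    simpa using hL
  have h := hg.le_slope_of_hasDerivAt (Set.mem_univ 0) (Set.mem_univ 1) zero_lt_one hd
  simp [slope_def_field] at h
  rw [map_sub]
  linarith

theorem track_bound (dd : ℕ → ℕ) (K : ℕ) (Lf : ℝ) (hLf : 1 ≤ Lf)
    (f : (k : ℕ) → EuclideanSpace ℝ (Fin (dd k)) → EuclideanSpace ℝ (Fin (dd (k + 1))))
    (hflip : ∀ k, k < K → ∀ a b, ‖f k a - f k b‖ ≤ Lf * ‖a - b‖)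
    (u : (i : ℕ) → EuclideanSpace ℝ (Fin (dd i))) (i : ℕ) (hi : i ≤ K) :
    Lf * ‖u i - chainComp (E := fun k => EuclideanSpace ℝ (Fin (dd k))) f i (u 0)‖ ≤
      ∑ j ∈ Finset.range i, Lf ^ (i - j) * ‖u (j + 1) - f j (u j)‖ := by
  have hL : 0 ≤ Lf := by linarith
  induction i with
  | zero => simp [chainComp]
  | succ i ih =>
    have h1 := ih (by omega)
    have h2 := hflip i (by omega) (u i)
      (chainComp (E := fun k => EuclideanSpace ℝ (Fin (dd k))) f i (u 0))
    have h3 := norm_sub_le_norm_sub_add_norm_sub (u (i+1)) (f i (u i))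
      (f i (chainComp (E := fun k => EuclideanSpace ℝ (Fin (dd k))) f i (u 0)))
    have e : ∑ j ∈ Finset.range i, Lf ^ (i + 1 - j) * ‖u (j + 1) - f j (u j)‖
        = Lf * ∑ j ∈ Finset.range i, Lf ^ (i - j) * ‖u (j + 1) - f j (u j)‖ := by
      rw [Finset.mul_sum]
      refine Finset.sum_congr rfl fun j hj => ?_
      have : i + 1 - j = (i - j) + 1 := by have := Finset.mem_range.1 hj; omega
      rw [this]; ring
    rw [Finset.sum_range_succ, e]
    have : i + 1 - i = 1 := by omega
    rw [this, pow_one]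
    have h4 := mul_le_mul_of_nonneg_left (h3.trans (add_le_add_right h2 _)) hL
    have h5 := mul_le_mul_of_nonneg_left h1 hL
    simp only [chainComp]
    linarith

theorem sum_Icc_shift (g : ℕ → ℝ) (n : ℕ) :
    ∑ i ∈ Finset.Icc 1 n, g i = ∑ i ∈ Finset.range n, g (i + 1) := by
  induction n with
  | zero => simp
  | succ n ih => rw [Finset.sum_Icc_succ_top (by omega), ih, Finset.sum_range_succ]

theorem young_term (Lf p R t : ℝ) (hLf : 1 ≤ Lf) (m n : ℕ) (hmn : m ≤ n) (hp : 0 ≤ p) (hR : 0 ≤ R)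
    (ht : 0 < t) : 2 * (Lf ^ m * p) * R ≤ t * Lf ^ n * R ^ 2 + 1 / t * (Lf ^ n * p ^ 2) := by
  have h1 : Lf ^ m ≤ Lf ^ n := pow_le_pow_right₀ hLf hmn
  have h2 : 2 * p * R ≤ t * R ^ 2 + 1 / t * p ^ 2 := by
    have : t * R ^ 2 + 1 / t * p ^ 2 - 2 * p * R = (t * R - p) ^ 2 / t := by
      field_simp; ring
    have h3 : 0 ≤ (t * R - p) ^ 2 / t := by positivity
    linarith
  calc 2 * (Lf ^ m * p) * R = Lf ^ m * (2 * p * R) := by ring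
    _ ≤ Lf ^ n * (2 * p * R) := by gcongr
    _ ≤ Lf ^ n * (t * R ^ 2 + 1 / t * p ^ 2) := by gcongr
    _ = _ := by ring

theorem tri_aux (i : ℕ) : i ≤ (i + 1) * i / 2 := by
  rw [Nat.le_div_iff_mul_le (by norm_num)]
  rcases i with _ | i
  · simp
  · nlinarith

/-- Deterministic per-iteration distance recursion for SVMR in the convex `K`-level setting.
Paper indices `i ∈ {1,…,K}`, `j ∈ {1,…,i-1}` are represented by Lean indices
`i' = i - 1 ∈ Finset.range K` and `j' = j - 1 ∈ Finset.range (i - 1)`. -/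
theorem stmt_19 (K : ℕ) (hK : 1 ≤ K) (Lf η γ lam : ℝ) (hLf : 1 ≤ Lf)
    (hη : 0 < η) (hγ : 0 < γ) (hlam : 0 < lam)
    (dd : ℕ → ℕ) (hdK : dd K = 1)
    (f : (k : ℕ) → EuclideanSpace ℝ (Fin (dd k)) → EuclideanSpace ℝ (Fin (dd (k + 1))))
    (Df : (k : ℕ) → EuclideanSpace ℝ (Fin (dd k)) → Matrix (Fin (dd k)) (Fin (dd (k + 1))) ℝ)
    (hfdiff : ∀ k, k < K → Differentiable ℝ (f k))
    (hflip : ∀ k, k < K → ∀ a b, ‖f k a - f k b‖ ≤ Lf * ‖a - b‖)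
    (hDflip : ∀ k, k < K → ∀ a b, frobNorm (Df k a - Df k b) ≤ Lf * ‖a - b‖)
    (hDf : ∀ k, k < K → ∀ y, Matrix.toEuclideanLin (Df k y)
        = (ContinuousLinearMap.adjoint (fderiv ℝ (f k) y)).toLinearMap)
    (F : EuclideanSpace ℝ (Fin (dd 0)) → ℝ)
    (hF : F = fun x => toScalar (chainComp (E := fun k => EuclideanSpace ℝ (Fin (dd k))) f K x))
    (hFconv : ConvexOn ℝ Set.univ F)
    (x xb : EuclideanSpace ℝ (Fin (dd 0)))
    (u : (i : ℕ) → EuclideanSpace ℝ (Fin (dd i))) (hu0 : u 0 = x)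
    (v : (i : ℕ) → Matrix (Fin (dd i)) (Fin (dd (i + 1))) ℝ)
    (hv : ∀ i, i < K → frobNorm (v i) ≤ Lf) :
    ‖x - η • toVec (matChainProd dd v K) - xb‖ ^ 2 ≤
      ‖x - xb‖ ^ 2 + Lf ^ (2 * K) * η ^ 2 - 2 * η * (F x - F xb)
        + γ * η * (∑ i ∈ Finset.Icc 1 K, ∑ j ∈ Finset.Icc 1 (i - 1),
            Lf ^ (K - j + i * (i - 1) / 2)) * ‖x - xb‖ ^ 2
        + (η / γ) * ∑ i ∈ Finset.Icc 1 K, ∑ j ∈ Finset.range (i - 1),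
            Lf ^ (K - (j + 1) + i * (i - 1) / 2) * ‖u (j + 1) - f j (u j)‖ ^ 2
        + lam * η * (∑ i ∈ Finset.Icc 1 K, Lf ^ (K - i + i * (i - 1) / 2)) * ‖x - xb‖ ^ 2
        + (η / lam) * ∑ i ∈ Finset.range K,
            Lf ^ (K - (i + 1) + (i + 1) * i / 2) * frobNorm (v i - Df i (u i)) ^ 2 := by
  have hL0 : 0 ≤ Lf := by linarith
  set c : (i : ℕ) → EuclideanSpace ℝ (Fin (dd i)) :=
    fun i => chainComp (E := fun k => EuclideanSpace ℝ (Fin (dd k))) f i x with hc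
  set g : (i : ℕ) → Matrix (Fin (dd i)) (Fin (dd (i + 1))) ℝ := fun i => Df i (c i) with hg
  set e : EuclideanSpace ℝ (Fin (dd K)) := WithLp.toLp 2 (fun _ => (1:ℝ)) with he
  have hen : ‖e‖ = 1 := by
    rw [EuclideanSpace.norm_eq]
    simp [he, hdK]
  have htv : toVec (matChainProd dd v K) = Matrix.toEuclideanLin (matChainProd dd v K) e := by
    ext i
    simp [toVec, he, Matrix.toLpLin_apply, Matrix.mulVec, dotProduct]
  set V := Matrix.toEuclideanLin (matChainProd dd v K) e with hV
  set G := Matrix.toEuclideanLin (matChainProd dd g K) e with hG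
  have hVn : ‖V‖ ≤ Lf ^ K := by
    simpa [hen] using chain_bound dd Lf hLf v K hv e
  -- operator norm bound of the true Jacobians
  have hgop : ∀ i, i < K → ∀ w, ‖Matrix.toEuclideanLin (g i) w‖ ≤ Lf * ‖w‖ := by
    intro i hi w
    rw [hg, hDf i hi]
    refine (ContinuousLinearMap.le_opNorm _ w).trans ?_
    refine mul_le_mul_of_nonneg_right ?_ (norm_nonneg _)
    rw [LinearIsometryEquiv.norm_map]
    have hlip : LipschitzWith ⟨Lf, hL0⟩ (f i) :=
      LipschitzWith.of_dist_le_mul fun a b => by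
        rw [dist_eq_norm, dist_eq_norm]; exact hflip i hi a b
    exact norm_fderiv_le_of_lipschitz ℝ hlip
  have hdiff := chain_diff dd Lf hLf v g K hv hgop e
  rw [hen, mul_one] at hdiff
  -- first-order convexity
  have hconv : F x - F xb ≤ inner ℝ G (x - xb) := by
    obtain ⟨L, hL, hw⟩ := chain_deriv dd f Df x K hfdiff hDf
    have hFe : F = fun z => inner ℝ e
        (chainComp (E := fun k => EuclideanSpace ℝ (Fin (dd k))) f K z) := by
      rw [hF]; funext z
      simp [toScalar, he, PiLp.inner_apply]
    have hFd : HasFDerivAt F ((innerSL ℝ e).comp L) x := by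
      rw [hFe]
      exact (innerSL ℝ e).hasFDerivAt.comp x hL
    have := convex_grad F hFconv x xb _ hFd
    refine this.trans (le_of_eq ?_)
    exact (hw e (x - xb)).symm
  set R := ‖x - xb‖ with hR
  have hR0 : 0 ≤ R := norm_nonneg _
  have hdelta : ∀ i, i < K → frobNorm (v i - g i) ≤ frobNorm (v i - Df i (u i)) +
      ∑ j ∈ Finset.range i, Lf ^ (i - j) * ‖u (j + 1) - f j (u j)‖ := by
    intro i hi
    have h1 := frobNorm_add_le (v i - Df i (u i)) (Df i (u i) - g i)
    rw [sub_add_sub_cancel] at h1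
    have h2 := hDflip i hi (u i) (c i)
    have h3 := track_bound dd K Lf hLf f hflip u i hi.le
    rw [hu0] at h3
    exact h1.trans (add_le_add_right (h2.trans h3) _)
  have hVG : ‖V - G‖ ≤ Lf ^ (K - 1) * ∑ i ∈ Finset.range K, frobNorm (v i - g i) := by
    have : Lf ^ K = Lf * Lf ^ (K - 1) := by
      rw [← pow_succ']; congr 1; omega
    rw [this, mul_assoc] at hdiff
    exact le_of_mul_le_mul_left hdiff (by linarith)
  have hmain : 2 * ‖V - G‖ * R ≤
      (∑ i ∈ Finset.range K, ∑ j ∈ Finset.range i,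
        (γ * Lf ^ (K - (j + 1) + (i + 1) * i / 2) * R ^ 2 + 1 / γ *
          (Lf ^ (K - (j + 1) + (i + 1) * i / 2) * ‖u (j + 1) - f j (u j)‖ ^ 2)))
      + ∑ i ∈ Finset.range K, (lam * Lf ^ (K - (i + 1) + (i + 1) * i / 2) * R ^ 2 + 1 / lam *
          (Lf ^ (K - (i + 1) + (i + 1) * i / 2) * frobNorm (v i - Df i (u i)) ^ 2)) := by
    calc 2 * ‖V - G‖ * R ≤ 2 * (Lf ^ (K - 1) * ∑ i ∈ Finset.range K, frobNorm (v i - g i)) * R := by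
          gcongr
      _ = ∑ i ∈ Finset.range K, 2 * (Lf ^ (K - 1) * frobNorm (v i - g i)) * R := by
          rw [Finset.mul_sum, Finset.mul_sum, Finset.sum_mul]
      _ ≤ _ := by
          rw [← Finset.sum_add_distrib]
          refine Finset.sum_le_sum fun i hi => ?_
          have hi' := Finset.mem_range.1 hi
          have ht := tri_aux i
          have h1 : 2 * (Lf ^ (K - 1) * frobNorm (v i - g i)) * R ≤
              2 * (Lf ^ (K - 1) * (frobNorm (v i - Df i (u i)) +
                ∑ j ∈ Finset.range i, Lf ^ (i - j) * ‖u (j + 1) - f j (u j)‖)) * R := by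
            have := hdelta i hi'
            gcongr
          refine h1.trans ?_
          have h2 := young_term Lf (frobNorm (v i - Df i (u i))) R lam hLf (K - 1)
            (K - (i + 1) + (i + 1) * i / 2) (by omega) (frobNorm_nonneg' _) hR0 hlam
          have h3 : ∑ j ∈ Finset.range i,
              2 * (Lf ^ (K - 1 + (i - j)) * ‖u (j + 1) - f j (u j)‖) * R ≤
              ∑ j ∈ Finset.range i,
              (γ * Lf ^ (K - (j + 1) + (i + 1) * i / 2) * R ^ 2 + 1 / γ *
              (Lf ^ (K - (j + 1) + (i + 1) * i / 2) * ‖u (j + 1) - f j (u j)‖ ^ 2)) := by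
            refine Finset.sum_le_sum fun j hj => ?_
            have hj' := Finset.mem_range.1 hj
            exact young_term Lf _ R γ hLf _ _ (by omega) (norm_nonneg _) hR0 hγ
          have h4 : 2 * (Lf ^ (K - 1) * (frobNorm (v i - Df i (u i)) +
                ∑ j ∈ Finset.range i, Lf ^ (i - j) * ‖u (j + 1) - f j (u j)‖)) * R =
              ∑ j ∈ Finset.range i,
              2 * (Lf ^ (K - 1 + (i - j)) * ‖u (j + 1) - f j (u j)‖) * R +
              2 * (Lf ^ (K - 1) * frobNorm (v i - Df i (u i))) * R := by
            rw [mul_add, mul_add, add_mul, add_comm]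
            congr 1
            rw [Finset.mul_sum, Finset.mul_sum, Finset.sum_mul]
            refine Finset.sum_congr rfl fun j _ => ?_
            rw [pow_add]; ring
          rw [h4]
          exact add_le_add h3 h2
  have hexp : ‖x - η • V - xb‖ ^ 2 = R ^ 2 - 2 * η * inner ℝ V (x - xb) + η ^ 2 * ‖V‖ ^ 2 := by
    have : x - η • V - xb = (x - xb) - η • V := by abel
    rw [this, norm_sub_sq_real, inner_smul_right, norm_smul, real_inner_comm, mul_pow,
      Real.norm_eq_abs, sq_abs]
    ring
  have hip : -(2 * η * inner ℝ V (x - xb)) ≤ -(2 * η * (F x - F xb)) + η * (2 * ‖V - G‖ * R) := by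
    have h1 : inner ℝ V (x - xb) = inner ℝ G (x - xb) + inner ℝ (V - G) (x - xb) := by
      rw [← inner_add_left, add_sub_cancel]
    have h2 : -(‖V - G‖ * R) ≤ inner ℝ (V - G) (x - xb) :=
      (abs_le.1 (abs_real_inner_le_norm _ _)).1
    have h3 : F x - F xb - ‖V - G‖ * R ≤ inner ℝ V (x - xb) := by rw [h1]; linarith
    have h4 := mul_le_mul_of_nonneg_left h3 hη.le
    linarith
  have hsq : η ^ 2 * ‖V‖ ^ 2 ≤ Lf ^ (2 * K) * η ^ 2 := by
    have : Lf ^ (2 * K) = (Lf ^ K) ^ 2 := by rw [← pow_mul, mul_comm]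
    rw [this, mul_comm]
    gcongr
  have hmain' := mul_le_mul_of_nonneg_left hmain hη.le
  rw [htv, hexp]
  simp only [sum_Icc_shift, Nat.add_sub_cancel]
  simp only [Finset.sum_add_distrib, ← Finset.mul_sum, ← Finset.sum_mul] at hmain'
  have e1 : ∀ t S : ℝ, η / t * S = η * (1 / t * S) := fun t S => by ring
  rw [e1, e1]
  linarith
end
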